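/- arXiv:math/0510159 — 2 statements merged into one kernel-verified Lean document; each statement's English description precedes it below -/
import Mathlib

section
/- Suppose x₀ ≥ 0 and x₁ ≥ 0. Then for every n ≥ 0, the row sums satisfy S(n+3) ≤ S(n+2) + 2·S(n+1) + 4·S(n). -/
/-- The random Fibonacci sequence determined by initial values `x0, x1` and the
sign sequence `ε : Fin n → Bool` (`true` ↦ `+1`, `false` ↦ `-1`):
`x 0 = x0`, `x 1 = x1`, `x (k+2) = (±1) * x (k+1) + x k` where the sign is `ε k`. -/
noncomputable def randFib (x0 x1 : ℝ) {n : ℕ} (ε : Fin n → Bool) : ℕ → ℝ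
  | 0 => x0
  | 1 => x1
  | k + 2 =>
      (if h : k < n then (if ε ⟨k, h⟩ then (1 : ℝ) else -1) else 1) *
        randFib x0 x1 ε (k + 1) + randFib x0 x1 ε k

/-- `rowSum x0 x1 n` is the sum of the absolute values of the `n`-th row of the tree
of all `2^n` random Fibonacci sequences with initial values `x0, x1`. -/
noncomputable def rowSum (x0 x1 : ℝ) (n : ℕ) : ℝ :=
  ∑ ε : Fin n → Bool, |randFib x0 x1 ε (n + 1)|

theorem randFib_cons (a b : ℝ) {n : ℕ} (s : Bool) (ε : Fin n → Bool) (k : ℕ) :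
    randFib a b (Fin.cons s ε : Fin (n + 1) → Bool) (k + 1) =
      randFib b ((if s then (1 : ℝ) else -1) * b + a) ε k := by
  induction k using Nat.twoStepInduction with
  | zero => simp [randFib]
  | one => simp [randFib]
  | more k ih₀ ih₁ =>
    rw [randFib, ih₁, ih₀, randFib]
    by_cases h : k < n
    · have hc : (Fin.cons s ε : Fin (n + 1) → Bool) ⟨k + 1, Nat.succ_lt_succ h⟩ = ε ⟨k, h⟩ :=
        Fin.cons_succ (α := fun _ => Bool) s ε ⟨k, h⟩
      simp [h, hc]
    · simp [h]

theorem rowSum_zero (a b : ℝ) : rowSum a b 0 = |b| := by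
  simp [rowSum, randFib]

/-- Splitting a row according to the first sign. -/
theorem rowSum_succ (a b : ℝ) (n : ℕ) :
    rowSum a b (n + 1) = rowSum b (b + a) n + rowSum b (-b + a) n := by
  unfold rowSum
  rw [← (Fin.consEquiv fun _ : Fin (n + 1) => Bool).sum_comp, Fintype.sum_prod_type]
  simp [Fin.consEquiv, randFib_cons]

/-- The recurrence inequality holds for arbitrary real initial values. -/
theorem rowSum_add_three_le (a b : ℝ) (n : ℕ) :
    rowSum a b (n + 3) ≤ rowSum a b (n + 2) + 2 * rowSum a b (n + 1) + 4 * rowSum a b n := by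
  induction n generalizing a b with
  | zero =>
    have h₁ := abs_add_le (a + b) (a + 2 * b)
    have h₂ := abs_add_le (a - b) (a - 2 * b)
    have h₃ := abs_add_le (a + b) a
    have h₄ := abs_add_le (a - b) a
    have e₁ : |-(b + a) + b| = |a| := by rw [← abs_neg a]; ring_nf
    have e₂ : |-(-b + a) + b| = |a - 2 * b| := by rw [← abs_neg (a - 2 * b)]; ring_nf
    have e₃ : |-(b + (-b + a)) + (-b + a)| = |b| := by
      rw [← abs_neg b]; ring_nf
    simp only [zero_add, rowSum_succ, rowSum_zero]
    ring_nf at *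
    linarith
  | succ n ih =>
    have h₁ := ih b (b + a)
    have h₂ := ih b (-b + a)
    rw [rowSum_succ a b (n + 3), rowSum_succ a b (n + 2), rowSum_succ a b (n + 1),
      rowSum_succ a b n]
    linarith

theorem rowSum_upper_recurrence (x0 x1 : ℝ) (hx0 : 0 ≤ x0) (hx1 : 0 ≤ x1) (n : ℕ) :
    rowSum x0 x1 (n + 3) ≤
      rowSum x0 x1 (n + 2) + 2 * rowSum x0 x1 (n + 1) + 4 * rowSum x0 x1 n :=
  rowSum_add_three_le x0 x1 n
end

section
/- Suppose x₀ > 0 and x₁ > 0. Then lim_{n→∞} (SS(n) − S(n)²/2ⁿ)^{1/n} = 1 + √5. Equivalently, writing μ₂(n) = SS(n)/2ⁿ − (S(n)/2ⁿ)² for the variance of |x_{n+1}| under the uniform distribution on the 2ⁿ sign sequences, one has lim_{n→∞} (2ⁿ·μ₂(n))^{1/n} = 1 + √5. -/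
open Filter

/-- `rowSumSq x0 x1 n` is the sum of the squares of the `n`-th row of the tree
of all `2^n` random Fibonacci sequences with initial values `x0, x1`. -/
noncomputable def rowSumSq (x0 x1 : ℝ) (n : ℕ) : ℝ :=
  ∑ ε : Fin n → Bool, (randFib x0 x1 ε (n + 1)) ^ 2

theorem randFib_snoc (x0 x1 : ℝ) {n : ℕ} (ε : Fin n → Bool) (b : Bool) :
    ∀ k ≤ n + 1, randFib x0 x1 (Fin.snoc ε b : Fin (n + 1) → Bool) k = randFib x0 x1 ε k
  | 0, _ => by simp only [randFib]
  | 1, _ => by simp only [randFib]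
  | k + 2, hk => by
    have hlt : k < n := by omega
    have hlt' : k < n + 1 := by omega
    have hs : (Fin.snoc ε b : Fin (n + 1) → Bool) ⟨k, hlt'⟩ = ε ⟨k, hlt⟩ :=
      Fin.snoc_castSucc (α := fun _ => Bool) (x := b) (p := ε) (i := ⟨k, hlt⟩)
    rw [randFib, randFib, randFib_snoc x0 x1 ε b (k + 1) (by omega),
      randFib_snoc x0 x1 ε b k (by omega), dif_pos hlt, dif_pos hlt', hs]

theorem randFib_snoc_last (x0 x1 : ℝ) {n : ℕ} (ε : Fin n → Bool) (b : Bool) :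
    randFib x0 x1 (Fin.snoc ε b : Fin (n + 1) → Bool) (n + 2) =
      (if b then (1 : ℝ) else -1) * randFib x0 x1 ε (n + 1) + randFib x0 x1 ε n := by
  have hs : (Fin.snoc ε b : Fin (n + 1) → Bool) ⟨n, n.lt_succ_self⟩ = b :=
    Fin.snoc_last (α := fun _ => Bool) (x := b) (p := ε)
  rw [randFib, randFib_snoc x0 x1 ε b (n + 1) le_rfl, randFib_snoc x0 x1 ε b n (by omega),
    dif_pos n.lt_succ_self, hs]

/-- Splitting a sum over a row of the tree according to the last sign. -/
theorem sum_randFib_succ (x0 x1 : ℝ) (n : ℕ) (F : ℝ → ℝ → ℝ) :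
    ∑ ε : Fin (n + 1) → Bool, F (randFib x0 x1 ε (n + 1)) (randFib x0 x1 ε (n + 2)) =
      ∑ ε : Fin n → Bool,
        (F (randFib x0 x1 ε (n + 1)) (randFib x0 x1 ε (n + 1) + randFib x0 x1 ε n) +
          F (randFib x0 x1 ε (n + 1)) (-randFib x0 x1 ε (n + 1) + randFib x0 x1 ε n)) := by
  rw [← (Fin.snocEquiv fun _ : Fin (n + 1) => Bool).sum_comp, Fintype.sum_prod_type_right]
  refine Finset.sum_congr rfl fun ε _ => ?_
  simp only [Fin.snocEquiv, Equiv.coe_fn_mk, Fintype.sum_bool, randFib_snoc_last,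
    randFib_snoc x0 x1 ε _ (n + 1) le_rfl]
  simp

theorem rowSumSq_add_two (x0 x1 : ℝ) (n : ℕ) :
    rowSumSq x0 x1 (n + 2) = 2 * rowSumSq x0 x1 (n + 1) + 4 * rowSumSq x0 x1 n := by
  have h := sum_randFib_succ x0 x1 (n + 1) fun _ v => v ^ 2
  have h' := sum_randFib_succ x0 x1 n fun u _ => u ^ 2
  unfold rowSumSq
  rw [h, Finset.mul_sum, Finset.mul_sum]
  have e : ∑ ε : Fin n → Bool, 4 * randFib x0 x1 ε (n + 1) ^ 2 =
      ∑ ε : Fin (n + 1) → Bool, 2 * randFib x0 x1 ε (n + 1) ^ 2 := by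
    rw [← Finset.mul_sum, ← Finset.mul_sum, h', Finset.sum_add_distrib]
    ring
  rw [e, ← Finset.sum_add_distrib]
  exact Finset.sum_congr rfl fun ε _ => by ring

theorem rowSumSq_zero (x0 x1 : ℝ) : rowSumSq x0 x1 0 = x1 ^ 2 := by
  simp [rowSumSq, randFib]

theorem rowSumSq_one (x0 x1 : ℝ) : rowSumSq x0 x1 1 = 2 * x1 ^ 2 + 2 * x0 ^ 2 := by
  have h := sum_randFib_succ x0 x1 0 fun _ v => v ^ 2
  unfold rowSumSq
  rw [h]
  simp [randFib]
  ring

theorem abs_add_add_abs_neg_add (u v : ℝ) : |v + u| + |-v + u| = 2 * max |u| |v| := by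
  rcases abs_cases (v + u) with h1 | h1 <;> rcases abs_cases (-v + u) with h2 | h2 <;>
  rcases abs_cases u with h3 | h3 <;> rcases abs_cases v with h4 | h4 <;>
  rcases max_cases |u| |v| with h5 | h5 <;> linarith

theorem sq_le_min_sq_add_min_sq (u v : ℝ) :
    v ^ 2 ≤ min (v ^ 2) ((v + u) ^ 2) + min (v ^ 2) ((-v + u) ^ 2) := by
  have h1 : 0 ≤ min (v ^ 2) ((v + u) ^ 2) := le_min (sq_nonneg _) (sq_nonneg _)
  have h2 : 0 ≤ min (v ^ 2) ((-v + u) ^ 2) := le_min (sq_nonneg _) (sq_nonneg _)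
  rcases le_total 0 (v * u) with h | h
  · rw [min_eq_left (show v ^ 2 ≤ (v + u) ^ 2 by nlinarith [sq_nonneg u])]
    linarith
  · rw [min_eq_left (show v ^ 2 ≤ (-v + u) ^ 2 by nlinarith [sq_nonneg u])]
    linarith

theorem two_mul_sum_min_sq_le (x0 x1 : ℝ) (n : ℕ) :
    2 * ∑ ε : Fin n → Bool, min (randFib x0 x1 ε n ^ 2) (randFib x0 x1 ε (n + 1) ^ 2) ≤
      rowSumSq x0 x1 (n + 1) - rowSum x0 x1 (n + 1) ^ 2 / 2 ^ (n + 1) := by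
  have hS : rowSum x0 x1 (n + 1) =
      2 * ∑ ε : Fin n → Bool, max |randFib x0 x1 ε n| |randFib x0 x1 ε (n + 1)| := by
    rw [rowSum, sum_randFib_succ x0 x1 n fun _ v => |v|, Finset.mul_sum]
    exact Finset.sum_congr rfl fun ε _ => abs_add_add_abs_neg_add _ _
  have hSS : rowSumSq x0 x1 (n + 1) =
      2 * ∑ ε : Fin n → Bool, max |randFib x0 x1 ε n| |randFib x0 x1 ε (n + 1)| ^ 2 +
      2 * ∑ ε : Fin n → Bool, min (randFib x0 x1 ε n ^ 2) (randFib x0 x1 ε (n + 1) ^ 2) := by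
    rw [rowSumSq, sum_randFib_succ x0 x1 n fun _ v => v ^ 2, ← mul_add,
      ← Finset.sum_add_distrib, Finset.mul_sum]
    refine Finset.sum_congr rfl fun ε _ => ?_
    rcases le_total |randFib x0 x1 ε n| |randFib x0 x1 ε (n + 1)| with h | h
    · rw [max_eq_right h, min_eq_left (sq_le_sq.2 h), sq_abs]
      ring
    · rw [max_eq_left h, min_eq_right (sq_le_sq.2 h), sq_abs]
      ring
  have hCS := sq_sum_le_card_mul_sum_sq (s := (Finset.univ : Finset (Fin n → Bool)))
    (f := fun ε => max |randFib x0 x1 ε n| |randFib x0 x1 ε (n + 1)|)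
  simp only [Finset.card_univ, Fintype.card_pi, Fintype.card_bool, Finset.prod_const,
    Fintype.card_fin, Nat.cast_pow, Nat.cast_ofNat] at hCS
  have hle : rowSum x0 x1 (n + 1) ^ 2 / 2 ^ (n + 1) ≤
      2 * ∑ ε : Fin n → Bool, max |randFib x0 x1 ε n| |randFib x0 x1 ε (n + 1)| ^ 2 := by
    rw [div_le_iff₀ (by positivity), hS, pow_succ 2 n, mul_pow]
    linarith
  linarith

theorem two_mul_rowSumSq_le (x0 x1 : ℝ) (n : ℕ) :
    2 * rowSumSq x0 x1 n ≤
      rowSumSq x0 x1 (n + 2) - rowSum x0 x1 (n + 2) ^ 2 / 2 ^ (n + 2) := by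
  refine le_trans ?_ (two_mul_sum_min_sq_le x0 x1 (n + 1))
  rw [sum_randFib_succ x0 x1 n fun u v => min (u ^ 2) (v ^ 2), rowSumSq]
  gcongr
  exact sq_le_min_sq_add_min_sq _ _

theorem one_add_sqrt_five_sq :
    (1 + Real.sqrt 5) ^ 2 = 2 * (1 + Real.sqrt 5) + 4 := by
  nlinarith [Real.sq_sqrt (show (0 : ℝ) ≤ 5 by norm_num)]

theorem mul_pow_le_rowSumSq {x0 x1 c : ℝ} (h0 : c ≤ rowSumSq x0 x1 0)
    (h1 : c * (1 + Real.sqrt 5) ≤ rowSumSq x0 x1 1) :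
    ∀ n, c * (1 + Real.sqrt 5) ^ n ≤ rowSumSq x0 x1 n
  | 0 => by simpa using h0
  | 1 => by simpa using h1
  | n + 2 => by
    have hn := mul_pow_le_rowSumSq h0 h1 n
    have hn' := mul_pow_le_rowSumSq h0 h1 (n + 1)
    rw [rowSumSq_add_two, pow_add, one_add_sqrt_five_sq]
    rw [pow_succ] at hn'
    linarith

theorem rowSumSq_le_mul_pow {x0 x1 C : ℝ} (h0 : rowSumSq x0 x1 0 ≤ C)
    (h1 : rowSumSq x0 x1 1 ≤ C * (1 + Real.sqrt 5)) :
    ∀ n, rowSumSq x0 x1 n ≤ C * (1 + Real.sqrt 5) ^ n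
  | 0 => by simpa using h0
  | 1 => by simpa using h1
  | n + 2 => by
    have hn := rowSumSq_le_mul_pow h0 h1 n
    have hn' := rowSumSq_le_mul_pow h0 h1 (n + 1)
    rw [rowSumSq_add_two, pow_add, one_add_sqrt_five_sq]
    rw [pow_succ] at hn'
    linarith

theorem tendsto_mul_pow_rpow_inv {c r : ℝ} (hc : 0 < c) (hr : 0 ≤ r) :
    Tendsto (fun n : ℕ => (c * r ^ n) ^ ((n : ℝ)⁻¹)) atTop (nhds r) := by
  have h : Tendsto (fun n : ℕ => c ^ ((n : ℝ)⁻¹) * r) atTop (nhds (c ^ (0 : ℝ) * r)) :=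
    ((Real.continuousAt_const_rpow hc.ne').tendsto.comp
      tendsto_inv_atTop_nhds_zero_nat).mul_const r
  rw [Real.rpow_zero, one_mul] at h
  refine h.congr' ?_
  filter_upwards [eventually_ne_atTop 0] with n hn
  rw [Real.mul_rpow hc.le (pow_nonneg hr n), Real.pow_rpow_inv_natCast hr hn]

theorem tendsto_rpow_inv_of_le_of_le {f : ℕ → ℝ} {c C r : ℝ} (hc : 0 < c) (hC : 0 < C)
    (hr : 0 ≤ r) (hl : ∀ᶠ n in atTop, c * r ^ n ≤ f n) (hu : ∀ᶠ n in atTop, f n ≤ C * r ^ n) :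
    Tendsto (fun n : ℕ => f n ^ ((n : ℝ)⁻¹)) atTop (nhds r) := by
  refine tendsto_of_tendsto_of_tendsto_of_le_of_le' (tendsto_mul_pow_rpow_inv hc hr)
    (tendsto_mul_pow_rpow_inv hC hr) ?_ ?_
  · filter_upwards [hl] with n hn
    exact Real.rpow_le_rpow (by positivity) hn (by positivity)
  · filter_upwards [hl, hu] with n hn hn'
    exact Real.rpow_le_rpow (le_trans (by positivity) hn) hn' (by positivity)

theorem variance_root_tendsto (x0 x1 : ℝ) (hx0 : 0 < x0) (hx1 : 0 < x1) :
    Tendsto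
      (fun n : ℕ => (rowSumSq x0 x1 n - (rowSum x0 x1 n) ^ 2 / 2 ^ n) ^ ((n : ℝ)⁻¹))
      atTop (nhds (1 + Real.sqrt 5)) ∧
    Tendsto
      (fun n : ℕ =>
        (2 ^ n * (rowSumSq x0 x1 n / 2 ^ n - (rowSum x0 x1 n / 2 ^ n) ^ 2)) ^ ((n : ℝ)⁻¹))
      atTop (nhds (1 + Real.sqrt 5)) := by
  have hr : 0 < 1 + Real.sqrt 5 := by positivity
  have h0 : 0 < rowSumSq x0 x1 0 := by rw [rowSumSq_zero]; positivity
  have h1 : 0 < rowSumSq x0 x1 1 := by rw [rowSumSq_one]; positivity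
  obtain ⟨c, hc, hlow⟩ : ∃ c > 0, ∀ n, c * (1 + Real.sqrt 5) ^ n ≤ rowSumSq x0 x1 n :=
    ⟨min (rowSumSq x0 x1 0) (rowSumSq x0 x1 1 / (1 + Real.sqrt 5)),
      lt_min h0 (div_pos h1 hr),
      mul_pow_le_rowSumSq (min_le_left _ _) ((le_div_iff₀ hr).1 (min_le_right _ _))⟩
  obtain ⟨C, hC, hupp⟩ : ∃ C > 0, ∀ n, rowSumSq x0 x1 n ≤ C * (1 + Real.sqrt 5) ^ n :=
    ⟨max (rowSumSq x0 x1 0) (rowSumSq x0 x1 1 / (1 + Real.sqrt 5)),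
      lt_max_of_lt_left h0,
      rowSumSq_le_mul_pow (le_max_left _ _) ((div_le_iff₀ hr).1 (le_max_right _ _))⟩
  have key : Tendsto
      (fun n : ℕ => (rowSumSq x0 x1 n - (rowSum x0 x1 n) ^ 2 / 2 ^ n) ^ ((n : ℝ)⁻¹))
      atTop (nhds (1 + Real.sqrt 5)) := by
    refine tendsto_rpow_inv_of_le_of_le (c := 2 * c / (1 + Real.sqrt 5) ^ 2) (by positivity)
      hC hr.le ?_ (Eventually.of_forall fun n => ?_)
    · filter_upwards [eventually_ge_atTop 2] with n hn
      obtain ⟨m, rfl⟩ := Nat.exists_eq_add_of_le' hn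
      refine le_trans (le_of_eq_of_le ?_ (mul_le_mul_of_nonneg_left (hlow m) zero_le_two))
        (two_mul_rowSumSq_le x0 x1 m)
      rw [pow_add]
      field_simp
    · have hnn : 0 ≤ rowSum x0 x1 n ^ 2 / 2 ^ n := by positivity
      linarith [hupp n]
  refine ⟨key, key.congr fun n => ?_⟩
  congr 1
  field_simp
end
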